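/- For all real s with 0 < s < 1, π·cot(πs) + s < ζ(s) - ψ(s) < π·cot(πs) + (γ + 1/2)·s + (γ - 1/2), where γ is the Euler–Mascheroni constant. -/

import Mathlib

/-- The real digamma function `ψ = Γ'/Γ`. -/
noncomputable def digammaReal (x : ℝ) : ℝ := deriv Real.Gamma x / Real.Gamma x

section

open Filter Topology Set

theorem differentiableAt_Gamma_of_pos {x : ℝ} (hx : 0 < x) : DifferentiableAt ℝ Real.Gamma x :=
  Real.differentiableAt_Gamma fun m ↦ by
    have : (0 : ℝ) ≤ m := m.cast_nonneg
    linarith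

theorem digammaReal_add_one {x : ℝ} (hx : 0 < x) :
    digammaReal (x + 1) = digammaReal x + 1 / x := by
  have hG := (Real.Gamma_pos_of_pos hx).ne'
  have h1 : HasDerivAt (fun y ↦ Real.Gamma (y + 1)) (deriv Real.Gamma (x + 1)) x :=
    (differentiableAt_Gamma_of_pos (by linarith)).hasDerivAt.comp_add_const x 1
  have h2 : HasDerivAt (fun y ↦ y * Real.Gamma y) (1 * Real.Gamma x + x * deriv Real.Gamma x) x :=
    (hasDerivAt_id x).mul (differentiableAt_Gamma_of_pos hx).hasDerivAt
  have h3 := h1.unique (h2.congr_of_eventuallyEq (by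
    filter_upwards [eventually_ne_nhds hx.ne'] with y hy using Real.Gamma_add_one hy))
  rw [digammaReal, digammaReal, h3, Real.Gamma_add_one hx.ne']
  field_simp
  ring

theorem digammaReal_eq_deriv_log_Gamma {x : ℝ} (hx : 0 < x) :
    digammaReal x = deriv (Real.log ∘ Real.Gamma) x := by
  rw [Function.comp_def, deriv.log (differentiableAt_Gamma_of_pos hx)
    (Real.Gamma_pos_of_pos hx).ne', digammaReal]

theorem slope_log_Gamma {x : ℝ} (hx : 0 < x) :
    slope (Real.log ∘ Real.Gamma) x (x + 1) = Real.log x := by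
  rw [slope_def_field, Function.comp_apply, Function.comp_apply, Real.Gamma_add_one hx.ne',
    Real.log_mul hx.ne' (Real.Gamma_pos_of_pos hx).ne']
  ring

theorem differentiableAt_log_Gamma {x : ℝ} (hx : 0 < x) :
    DifferentiableAt ℝ (Real.log ∘ Real.Gamma) x :=
  (differentiableAt_Gamma_of_pos hx).log (Real.Gamma_pos_of_pos hx).ne'

theorem digammaReal_le_log {x : ℝ} (hx : 0 < x) : digammaReal x ≤ Real.log x := by
  rw [digammaReal_eq_deriv_log_Gamma hx, ← slope_log_Gamma hx]
  exact Real.convexOn_log_Gamma.deriv_le_slope hx (by simp; linarith) (by linarith)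
    (differentiableAt_log_Gamma hx)

theorem log_sub_inv_le_digammaReal {x : ℝ} (hx : 0 < x) :
    Real.log x - 1 / x ≤ digammaReal x := by
  rw [sub_le_iff_le_add, ← digammaReal_add_one hx,
    digammaReal_eq_deriv_log_Gamma (by linarith), ← slope_log_Gamma hx]
  exact Real.convexOn_log_Gamma.slope_le_deriv hx (by simp; linarith) (by linarith)
    (differentiableAt_log_Gamma (by linarith))

theorem tendsto_log_sub_digammaReal :
    Tendsto (fun x ↦ Real.log x - digammaReal x) atTop (𝓝 0) := by
  refine tendsto_of_tendsto_of_tendsto_of_le_of_le' tendsto_const_nhds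
    (tendsto_const_nhds.div_atTop tendsto_id : Tendsto (fun x : ℝ ↦ 1 / x) atTop (𝓝 0)) ?_ ?_
  · filter_upwards [eventually_gt_atTop 0] with x hx
    linarith [digammaReal_le_log hx]
  · filter_upwards [eventually_gt_atTop 0] with x hx
    linarith [log_sub_inv_le_digammaReal hx]

theorem digammaReal_add_nat {x : ℝ} (hx : 0 < x) (N : ℕ) :
    digammaReal (x + N) = digammaReal x + ∑ k ∈ Finset.range N, 1 / (x + k) := by
  induction N with
  | zero => simp
  | succ N ih =>
    rw [Finset.sum_range_succ, ← add_assoc, ← ih, ← digammaReal_add_one (by positivity)]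
    push_cast
    ring_nf

/-- Euler's limit for the digamma function. -/
theorem tendsto_sum_inv_sub_log_digammaReal {x : ℝ} (hx : 0 < x) :
    Tendsto (fun N : ℕ ↦ ∑ k ∈ Finset.range N, 1 / (x + k) - Real.log (x + N)) atTop
      (𝓝 (-digammaReal x)) := by
  have h := (tendsto_log_sub_digammaReal.comp
    (tendsto_atTop_add_const_left _ x tendsto_natCast_atTop_atTop)).neg.sub_const (digammaReal x)
  rw [neg_zero, zero_sub] at h
  refine h.congr fun N ↦ ?_
  simp only [Function.comp_apply, digammaReal_add_nat hx]
  ring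

theorem digammaReal_one_sub {s : ℝ} (hs : 0 < s) (hs1 : s < 1) :
    digammaReal (1 - s) = digammaReal s + Real.pi * Real.cot (Real.pi * s) := by
  have hG := (Real.Gamma_pos_of_pos hs).ne'
  have hG' := (Real.Gamma_pos_of_pos (sub_pos.2 hs1)).ne'
  have hsin : Real.sin (Real.pi * s) ≠ 0 :=
    (Real.sin_pos_of_pos_of_lt_pi (by positivity) (by nlinarith [Real.pi_pos])).ne'
  have h1 : HasDerivAt (fun y ↦ Real.Gamma y * Real.Gamma (1 - y))
      (deriv Real.Gamma s * Real.Gamma (1 - s) + Real.Gamma s * -deriv Real.Gamma (1 - s)) s :=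
    (differentiableAt_Gamma_of_pos hs).hasDerivAt.mul
      ((differentiableAt_Gamma_of_pos (sub_pos.2 hs1)).hasDerivAt.comp_const_sub 1 s)
  have h2 : HasDerivAt (fun y ↦ Real.pi / Real.sin (Real.pi * y))
      ((0 * Real.sin (Real.pi * s) - Real.pi * (Real.cos (Real.pi * s) * (Real.pi * 1))) /
        Real.sin (Real.pi * s) ^ 2) s :=
    (hasDerivAt_const s Real.pi).div (((hasDerivAt_id s).const_mul Real.pi).sin) hsin
  have h3 := h1.unique (h2.congr_of_eventuallyEq (Eventually.of_forall
    fun y ↦ Real.Gamma_mul_Gamma_one_sub y))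
  have h4 := Real.Gamma_mul_Gamma_one_sub s
  have h5 : deriv Real.Gamma (1 - s) / Real.Gamma (1 - s) - deriv Real.Gamma s / Real.Gamma s =
      -(deriv Real.Gamma s * Real.Gamma (1 - s) + Real.Gamma s * -deriv Real.Gamma (1 - s)) /
        (Real.Gamma s * Real.Gamma (1 - s)) := by
    field_simp
    ring
  rw [h3, h4] at h5
  rw [digammaReal, digammaReal, Real.cot_eq_cos_div_sin, ← sub_eq_iff_eq_add', h5]
  have := Real.pi_ne_zero
  field_simp
  ring

/-- The terms of the series of `(s - 1) ζ(s) - 1` that converges for `0 < re s`. -/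
noncomputable def zetaTerm (s : ℂ) (n : ℕ) : ℂ :=
  (s - 1) * (n + 1 : ℂ) ^ (-s) + ((n + 2 : ℂ) ^ (1 - s) - (n + 1 : ℂ) ^ (1 - s))

theorem hasDerivAt_add_ofReal_cpow {x : ℝ} (hx : 0 < x) (r : ℂ) {t : ℝ} (ht : 0 ≤ t) :
    HasDerivAt (fun t : ℝ ↦ ((x : ℂ) + t) ^ r) (r * ((x : ℂ) + t) ^ (r - 1)) t := by
  have hm : (x : ℂ) + (t : ℂ) ∈ Complex.slitPlane := by
    rw [← Complex.ofReal_add, Complex.ofReal_mem_slitPlane]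
    linarith
  simpa using (((hasDerivAt_id (t : ℂ)).const_add (x : ℂ)).cpow_const (c := r) hm).comp_ofReal

theorem norm_add_cpow_sub_cpow_le {x : ℝ} (hx : 0 < x) {s : ℂ} (hs : 0 < s.re) {t : ℝ}
    (ht : t ∈ Icc (0 : ℝ) 1) :
    ‖((x : ℂ) + t) ^ (-s) - (x : ℂ) ^ (-s)‖ ≤ ‖s‖ * x ^ (-s.re - 1) := by
  have key := norm_image_sub_le_of_norm_deriv_le_segment_01'
    (f := fun u : ℝ ↦ ((x : ℂ) + ((t * u : ℝ) : ℂ)) ^ (-s))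
    (f' := fun u : ℝ ↦ t • (-s * ((x : ℂ) + ((t * u : ℝ) : ℂ)) ^ (-s - 1)))
    (C := ‖s‖ * x ^ (-s.re - 1)) (fun u hu ↦ ?_) (fun u hu ↦ ?_)
  · simpa using key
  · have h := (hasDerivAt_add_ofReal_cpow hx (-s) (t := t * u) (mul_nonneg ht.1 hu.1))
    exact (h.scomp u (by simpa using (hasDerivAt_id u).const_mul t)).hasDerivWithinAt
  · have htu : 0 ≤ t * u := mul_nonneg ht.1 hu.1
    rw [← Complex.ofReal_add, norm_smul, norm_mul, norm_neg,
      Complex.norm_cpow_eq_rpow_re_of_pos (by linarith), Real.norm_of_nonneg ht.1]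
    have h1 : (x + t * u) ^ (-s - 1).re ≤ x ^ (-s.re - 1) := by
      simpa using Real.rpow_le_rpow_of_nonpos hx (by linarith : x ≤ x + t * u)
        (by linarith : -s.re - 1 ≤ 0)
    calc t * (‖s‖ * (x + t * u) ^ (-s - 1).re) ≤ 1 * (‖s‖ * (x + t * u) ^ (-s - 1).re) := by
          gcongr; exact ht.2
      _ ≤ _ := by rw [one_mul]; gcongr

theorem norm_zetaTerm_le {s : ℂ} (hs : 0 < s.re) (n : ℕ) :
    ‖zetaTerm s n‖ ≤ ‖s - 1‖ * ‖s‖ * (n + 1 : ℝ) ^ (-s.re - 1) := by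
  have hx : (0 : ℝ) < n + 1 := by positivity
  have key := norm_image_sub_le_of_norm_deriv_le_segment_01'
    (f := fun t : ℝ ↦ (s - 1) * t * (((n + 1 : ℝ) : ℂ)) ^ (-s) +
      ((((n + 1 : ℝ) : ℂ)) + t) ^ (1 - s))
    (f' := fun t : ℝ ↦ (s - 1) * 1 * (((n + 1 : ℝ) : ℂ)) ^ (-s) +
      (1 - s) * ((((n + 1 : ℝ) : ℂ)) + t) ^ (1 - s - 1))
    (C := ‖s - 1‖ * ‖s‖ * (n + 1 : ℝ) ^ (-s.re - 1)) (fun t ht ↦ ?_) (fun t ht ↦ ?_)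
  · refine (le_of_eq (congrArg norm ?_)).trans key
    rw [zetaTerm]
    push_cast
    ring_nf
  · exact ((((hasDerivAt_id (t : ℂ)).comp_ofReal.const_mul (s - 1)).mul_const _).add
      (hasDerivAt_add_ofReal_cpow hx _ ht.1)).hasDerivWithinAt
  · have h : (s - 1) * 1 * (((n + 1 : ℝ) : ℂ)) ^ (-s) +
        (1 - s) * ((((n + 1 : ℝ) : ℂ)) + t) ^ (1 - s - 1) =
        -(s - 1) * (((((n + 1 : ℝ) : ℂ)) + t) ^ (-s) - (((n + 1 : ℝ) : ℂ)) ^ (-s)) := by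
      rw [show 1 - s - 1 = -s by ring]
      ring
    rw [h, norm_mul, norm_neg, mul_assoc]
    gcongr
    exact norm_add_cpow_sub_cpow_le hx hs ⟨ht.1, ht.2.le⟩

theorem sum_zetaTerm (s : ℂ) (N : ℕ) :
    ∑ n ∈ Finset.range N, zetaTerm s n =
      (s - 1) * ∑ n ∈ Finset.range N, (n + 1 : ℂ) ^ (-s) + (N + 1 : ℂ) ^ (1 - s) - 1 := by
  induction N with
  | zero => simp
  | succ N ih =>
    rw [Finset.sum_range_succ, ih, Finset.sum_range_succ, zetaTerm]
    push_cast
    ring_nf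

theorem summable_add_one_rpow {ε : ℝ} (hε : 0 < ε) :
    Summable fun n : ℕ ↦ (n + 1 : ℝ) ^ (-ε - 1) := by
  have := (summable_nat_add_iff 1).2 (Real.summable_nat_rpow.2 (by linarith : -ε - 1 < -1))
  simpa using this

theorem summable_zetaTerm {s : ℂ} (hs : 0 < s.re) : Summable (zetaTerm s) :=
  .of_norm_bounded ((summable_add_one_rpow hs).mul_left _) (norm_zetaTerm_le hs)

theorem tsum_zetaTerm_of_one_lt_re {s : ℂ} (hs : 1 < s.re) :
    ∑' n, zetaTerm s n = (s - 1) * riemannZeta s - 1 := by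
  refine tendsto_nhds_unique (summable_zetaTerm (by linarith)).hasSum.tendsto_sum_nat ?_
  simp_rw [sum_zetaTerm]
  have h1 : Summable fun n : ℕ ↦ (n + 1 : ℂ) ^ (-s) := by
    have := (summable_nat_add_iff 1).2 (Complex.summable_one_div_nat_cpow.2 hs)
    simpa [Complex.cpow_neg] using this
  have h2 : Tendsto (fun N : ℕ ↦ (N + 1 : ℂ) ^ (1 - s)) atTop (𝓝 0) := by
    rw [tendsto_zero_iff_norm_tendsto_zero]
    have := (tendsto_rpow_neg_atTop (by linarith : 0 < s.re - 1)).comp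
      (tendsto_atTop_add_const_right _ (1 : ℝ) tendsto_natCast_atTop_atTop)
    refine this.congr fun N ↦ ?_
    have h := Complex.norm_cpow_eq_rpow_re_of_pos (by positivity : (0 : ℝ) < N + 1) (1 - s)
    push_cast at h
    rw [h]
    simp
  have h3 := ((h1.hasSum.tendsto_sum_nat.const_mul (s - 1)).add h2).sub_const 1
  simpa [zeta_eq_tsum_one_div_nat_add_one_cpow hs, Complex.cpow_neg] using h3

theorem differentiableAt_sub_one_sq_mul_riemannZeta (s : ℂ) :
    DifferentiableAt ℂ (fun s ↦ (s - 1) ^ 2 * riemannZeta s) s := by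
  rcases eq_or_ne s 1 with rfl | hs
  · refine HasDerivAt.differentiableAt (f' := 1) ?_
    rw [hasDerivAt_iff_tendsto_slope]
    refine riemannZeta_residue_one.congr' ?_
    filter_upwards [self_mem_nhdsWithin] with z hz
    have : z - 1 ≠ 0 := sub_ne_zero.2 hz
    rw [slope_def_field]
    field_simp
    ring
  · exact (by fun_prop : DifferentiableAt ℂ (fun s : ℂ ↦ (s - 1) ^ 2) s).mul
      (differentiableAt_riemannZeta hs)

theorem differentiable_zetaTerm (n : ℕ) : Differentiable ℂ fun s ↦ zetaTerm s n := by
  intro s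
  have h1 : (n + 1 : ℂ) ≠ 0 := by exact_mod_cast n.succ_ne_zero
  have h2 : (n + 2 : ℂ) ≠ 0 := by exact_mod_cast (n + 1).succ_ne_zero
  unfold zetaTerm
  refine .add (.mul (by fun_prop) (.const_cpow (by fun_prop) (.inl h1)))
    (.sub (.const_cpow (by fun_prop) (.inl h2)) (.const_cpow (by fun_prop) (.inl h1)))

/-- The series for `(s - 1) ζ(s)` in the half plane `0 < re s`. -/
theorem tsum_zetaTerm {s : ℂ} (hs : 0 < s.re) (hs1 : s ≠ 1) :
    ∑' n, zetaTerm s n = (s - 1) * riemannZeta s - 1 := by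
  set ε := min (s.re / 2) 1
  have hε : 0 < ε := lt_min (by linarith) one_pos
  have hεs : ε < s.re := (min_le_left _ _).trans_lt (by linarith)
  have hε1 : ε ≤ 1 := min_le_right _ _
  set R := ‖s‖ + 3
  set V : Set ℂ := {z | ε < z.re} ∩ Metric.ball 0 R
  have hVo : IsOpen V := (isOpen_lt continuous_const Complex.continuous_re).inter Metric.isOpen_ball
  have hVc : IsPreconnected V :=
    ((convex_halfSpace_re_gt ε).inter (convex_ball 0 R)).isPreconnected
  have hsV : s ∈ V := ⟨hεs, by simp [R]⟩
  have h2V : (2 : ℂ) ∈ V := ⟨by simpa using by linarith, by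
    simp only [Metric.mem_ball, dist_zero_right, R, Complex.norm_ofNat]
    linarith [norm_nonneg s]⟩
  have hdiff : DifferentiableOn ℂ (fun z ↦ ∑' n, zetaTerm z n) V := by
    refine Complex.differentiableOn_tsum_of_summable_norm
      ((summable_add_one_rpow hε).mul_left ((R + 1) * R))
      (fun n ↦ (differentiable_zetaTerm n).differentiableOn) hVo fun n z hz ↦ ?_
    have hzR : ‖z‖ ≤ R := by simpa using (Metric.mem_ball.1 hz.2).le
    have hz1 : ‖z - 1‖ ≤ R + 1 := (norm_sub_le _ _).trans (by simpa using hzR)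
    have hzε : ε < z.re := hz.1
    refine (norm_zetaTerm_le (hε.trans hzε) n).trans ?_
    gcongr
    · linarith [n.cast_nonneg (α := ℝ)]
  have hL : DifferentiableOn ℂ (fun z ↦ (z - 1) * (1 + ∑' n, zetaTerm z n)) V :=
    (by fun_prop : DifferentiableOn ℂ (fun z : ℂ ↦ z - 1) V).mul (hdiff.const_add 1)
  have hR : DifferentiableOn ℂ (fun z ↦ (z - 1) ^ 2 * riemannZeta z) V :=
    fun z _ ↦ (differentiableAt_sub_one_sq_mul_riemannZeta z).differentiableWithinAt
  have heq := (hL.analyticOnNhd hVo).eqOn_of_preconnected_of_eventuallyEq (hR.analyticOnNhd hVo)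
    hVc h2V (by
      filter_upwards [(isOpen_lt continuous_const Complex.continuous_re).mem_nhds
        (by simp : (1 : ℝ) < (2 : ℂ).re)] with z hz
      rw [tsum_zetaTerm_of_one_lt_re hz]
      ring) hsV
  have h1 : s - 1 ≠ 0 := sub_ne_zero.2 hs1
  refine eq_sub_of_add_eq' (mul_left_cancel₀ h1 ?_)
  simp only at heq
  rw [heq]
  ring

/-- The limit formula for `ζ` on the interval `(0, 1)`. -/
theorem tendsto_sum_rpow_sub_riemannZeta {s : ℝ} (hs : 0 < s) (hs1 : s < 1) :
    Tendsto (fun N : ℕ ↦ ∑ n ∈ Finset.range N, (n + 1 : ℝ) ^ (-s) -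
      (N + 1 : ℝ) ^ (1 - s) / (1 - s)) atTop (𝓝 (riemannZeta s).re) := by
  have hne : (s : ℂ) ≠ 1 := by exact_mod_cast hs1.ne
  have h := (summable_zetaTerm (s := s) (by simpa using hs)).hasSum.tendsto_sum_nat
  rw [tsum_zetaTerm (by simpa using hs) hne] at h
  have h' := ((Complex.continuous_re.tendsto _).comp h).add_const 1 |>.div_const (s - 1)
  have hlim : (((s : ℂ) - 1) * riemannZeta s - 1).re = (s - 1) * (riemannZeta s).re - 1 := by
    rw [← Complex.ofReal_one, ← Complex.ofReal_sub, Complex.sub_re, Complex.re_ofReal_mul,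
      Complex.ofReal_re]
  have h0 : s - 1 ≠ 0 := by linarith
  have h0' : 1 - s ≠ 0 := by linarith
  rw [hlim, sub_add_cancel, mul_div_cancel_left₀ _ h0] at h'
  refine h'.congr fun N ↦ ?_
  have hsum : ∑ n ∈ Finset.range N, zetaTerm s n =
      (((s - 1) * ∑ n ∈ Finset.range N, (n + 1 : ℝ) ^ (-s) +
        (N + 1 : ℝ) ^ (1 - s) - 1 : ℝ) : ℂ) := by
    rw [sum_zetaTerm]
    push_cast
    rw [Complex.ofReal_cpow (by positivity)]
    have : ∀ n : ℕ, (((n + 1 : ℝ) ^ (-s) : ℝ) : ℂ) = (n + 1 : ℂ) ^ (-s : ℂ) := fun n ↦ by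
      rw [Complex.ofReal_cpow (by positivity)]; push_cast; rfl
    simp_rw [this]
    push_cast
    rfl
  simp only [Function.comp_apply]
  rw [hsum, Complex.ofReal_re, sub_add_cancel, ← neg_sub 1 s]
  field_simp
  ring

theorem le_of_hasDerivAt_nonpos {f f' : ℝ → ℝ} {a : ℝ}
    (hf : ∀ x ∈ Icc a (a + 1), HasDerivAt f (f' x) x) (hf' : ∀ x ∈ Icc a (a + 1), f' x ≤ 0) :
    f (a + 1) ≤ f a := by
  refine antitoneOn_of_deriv_nonpos (convex_Icc a (a + 1))
    (fun x hx ↦ (hf x hx).continuousAt.continuousWithinAt)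
    (fun x hx ↦ (hf x (interior_subset hx)).differentiableAt.differentiableWithinAt)
    (fun x hx ↦ ?_) (left_mem_Icc.2 (by linarith)) (right_mem_Icc.2 (by linarith)) (by linarith)
  rw [(hf x (interior_subset hx)).deriv]
  exact hf' x (interior_subset hx)

/-- One step of the Euler-Maclaurin formula of order six, as an inequality. -/
theorem euler_maclaurin_step {F f f₁ f₂ f₃ f₄ f₅ f₆ : ℝ → ℝ} {a : ℝ}
    (h : ∀ x ∈ Icc a (a + 1), HasDerivAt F (f x) x ∧ HasDerivAt f (f₁ x) x ∧
      HasDerivAt f₁ (f₂ x) x ∧ HasDerivAt f₂ (f₃ x) x ∧ HasDerivAt f₃ (f₄ x) x ∧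
      HasDerivAt f₄ (f₅ x) x ∧ HasDerivAt f₅ (f₆ x) x ∧ 0 ≤ f₆ x) :
    F (a + 1) - f (a + 1) / 2 + f₁ (a + 1) / 12 - f₃ (a + 1) / 720 ≤
      F a - f a / 2 + f₁ a / 12 - f₃ a / 720 + f a := by
  let p : Polynomial ℝ := .C (1 / 720) * .X ^ 6 - .C (1 / 240) * .X ^ 5 + .C (1 / 288) * .X ^ 4 -
    .C (1 / 1440) * .X ^ 2
  have hp (q : Polynomial ℝ) (x : ℝ) :
      HasDerivAt (fun x ↦ q.eval (x - a)) (q.derivative.eval (x - a)) x :=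
    (q.hasDerivAt (x - a)).comp_sub_const x a
  have key := le_of_hasDerivAt_nonpos (a := a)
    (f := fun x ↦ p.eval (x - a) * f₅ x - p.derivative.eval (x - a) * f₄ x +
      p.derivative.derivative.eval (x - a) * f₃ x -
      p.derivative.derivative.derivative.eval (x - a) * f₂ x +
      p.derivative.derivative.derivative.derivative.eval (x - a) * f₁ x -
      p.derivative.derivative.derivative.derivative.derivative.eval (x - a) * f x +
      p.derivative.derivative.derivative.derivative.derivative.derivative.eval (x - a) * F x)
    (f' := fun x ↦ p.eval (x - a) * f₆ x) (fun x hx ↦ ?_) (fun x hx ↦ ?_)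
  · simp only [p, Polynomial.derivative_add, Polynomial.derivative_sub, Polynomial.derivative_mul,
      Polynomial.derivative_C, Polynomial.derivative_X_pow, Polynomial.derivative_zero,
      Polynomial.eval_add, Polynomial.eval_sub, Polynomial.eval_mul, Polynomial.eval_C,
      Polynomial.eval_pow, Polynomial.eval_X, Polynomial.eval_zero] at key
    norm_num at key
    linarith
  · obtain ⟨h0, h1, h2, h3, h4, h5, h6, -⟩ := h x hx
    have h7 : p.derivative.derivative.derivative.derivative.derivative.derivative.derivative.eval
        (x - a) = 0 := by
      simp [p]
    convert! ((((((hp p x).mul h6).sub ((hp _ x).mul h5)).add ((hp _ x).mul h4)).sub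
      ((hp _ x).mul h3)).add ((hp _ x).mul h2)).sub ((hp _ x).mul h1) |>.add ((hp _ x).mul h0)
      using 1
    rw [h7]
    ring
  · have h6 := (h x hx).2.2.2.2.2.2.2
    have : p.eval (x - a) =
        -((x - a) ^ 2 * (1 - (x - a)) ^ 2 * (1 + 2 * ((x - a) * (1 - (x - a)))) / 1440) := by
      simp [p]
      ring
    have hx1 := mul_nonneg (sub_nonneg.2 hx.1) (by linarith [hx.2] : 0 ≤ 1 - (x - a))
    simp only [this]
    rw [neg_mul, neg_nonpos]
    positivity

theorem hasDerivAt_const_mul_rpow {x : ℝ} (hx : 0 < x) {c d p q : ℝ} (hq : q = p - 1)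
    (hd : d = c * p) : HasDerivAt (fun x : ℝ ↦ c * x ^ p) (d * x ^ q) x := by
  subst hq hd
  rw [mul_assoc]
  exact (Real.hasDerivAt_rpow_const (.inl hx.ne')).const_mul c

theorem tendsto_add_one_rpow_neg {a : ℝ} (ha : 0 < a) :
    Tendsto (fun N : ℕ ↦ (N + 1 : ℝ) ^ (-a)) atTop (𝓝 0) :=
  (tendsto_rpow_neg_atTop ha).comp
    (tendsto_atTop_add_const_right _ (1 : ℝ) tendsto_natCast_atTop_atTop)

theorem sum_range_ge_of_step {Φ f : ℕ → ℝ} (h : ∀ n, Φ (n + 1) ≤ Φ n + f n) (N : ℕ) :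
    Φ N - Φ 0 ≤ ∑ n ∈ Finset.range N, f n := by
  rw [← Finset.sum_range_sub]
  exact Finset.sum_le_sum fun n _ ↦ by linarith [h n]

theorem riemannZeta_lower_bound {s : ℝ} (hs : 0 < s) (hs1 : s < 1) :
    1 / 2 - 1 / (1 - s) + s / 12 - s * (s + 1) * (s + 2) / 720 ≤ (riemannZeta s).re := by
  have h1s : 1 - s ≠ 0 := by linarith
  have hstep (n : ℕ) := euler_maclaurin_step (a := (n + 1 : ℝ))
    (F := fun x ↦ 1 / (1 - s) * x ^ (1 - s)) (f := fun x ↦ 1 * x ^ (-s))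
    (f₁ := fun x ↦ -s * x ^ (-(s + 1))) (f₂ := fun x ↦ s * (s + 1) * x ^ (-(s + 2)))
    (f₃ := fun x ↦ -(s * (s + 1) * (s + 2)) * x ^ (-(s + 3)))
    (f₄ := fun x ↦ s * (s + 1) * (s + 2) * (s + 3) * x ^ (-(s + 4)))
    (f₅ := fun x ↦ -(s * (s + 1) * (s + 2) * (s + 3) * (s + 4)) * x ^ (-(s + 5)))
    (f₆ := fun x ↦ s * (s + 1) * (s + 2) * (s + 3) * (s + 4) * (s + 5) * x ^ (-(s + 6)))
    fun x hx ↦ by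
      have hx0 : 0 < x := by linarith [hx.1, n.cast_nonneg (α := ℝ)]
      refine ⟨hasDerivAt_const_mul_rpow hx0 (by ring) (by field_simp), ?_, ?_, ?_, ?_, ?_, ?_,
        by positivity⟩ <;> exact hasDerivAt_const_mul_rpow hx0 (by ring) (by ring)
  have hsum := sum_range_ge_of_step (f := fun n : ℕ ↦ 1 * (n + 1 : ℝ) ^ (-s))
    (Φ := fun n : ℕ ↦ 1 / (1 - s) * (n + 1 : ℝ) ^ (1 - s) - 1 * (n + 1 : ℝ) ^ (-s) / 2 +
      -s * (n + 1 : ℝ) ^ (-(s + 1)) / 12 -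
      -(s * (s + 1) * (s + 2)) * (n + 1 : ℝ) ^ (-(s + 3)) / 720)
    fun n ↦ by simpa only [Nat.cast_add, Nat.cast_one] using hstep n
  have hlim := ((((tendsto_add_one_rpow_neg hs).const_mul 1).div_const 2).neg.add
    (((tendsto_add_one_rpow_neg (by linarith : 0 < s + 1)).const_mul (-s)).div_const 12)).sub
    (((tendsto_add_one_rpow_neg (by linarith : 0 < s + 3)).const_mul
      (-(s * (s + 1) * (s + 2)))).div_const 720) |>.add_const
        (1 / 2 - 1 / (1 - s) + s / 12 - s * (s + 1) * (s + 2) / 720)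
  simp only [mul_zero, zero_div, neg_zero, add_zero, sub_zero, zero_add] at hlim
  refine le_of_tendsto_of_tendsto' hlim (tendsto_sum_rpow_sub_riemannZeta hs hs1) fun N ↦ ?_
  have := hsum N
  simp only [Nat.cast_zero, zero_add, Real.one_rpow, one_mul] at this
  rw [show (N + 1 : ℝ) ^ (1 - s) / (1 - s) = 1 / (1 - s) * (N + 1 : ℝ) ^ (1 - s) by ring]
  linarith

theorem hasDerivAt_const_div_pow {x : ℝ} (hx : 0 < x) {c d : ℝ} {p q : ℕ} (hq : q = p + 1)
    (hd : d = -(c * p)) : HasDerivAt (fun x : ℝ ↦ c / x ^ p) (d / x ^ q) x := by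
  subst hq hd
  convert! ((hasDerivAt_pow p x).fun_inv (pow_ne_zero _ hx.ne')).const_mul c using 1
  rcases p with _ | p
  · simp
  · simp only [Nat.add_sub_cancel]
    field_simp
    ring

theorem digammaReal_upper_bound {x : ℝ} (hx : 0 < x) :
    digammaReal x ≤
      Real.log x - 1 / (2 * x) - 1 / (12 * x ^ 2) + 1 / (120 * x ^ 4) := by
  have hstep (n : ℕ) := euler_maclaurin_step (a := (x + n : ℝ))
    (F := Real.log) (f := fun x ↦ 1 / x ^ 1)
    (f₁ := fun x ↦ -1 / x ^ 2) (f₂ := fun x ↦ 2 / x ^ 3) (f₃ := fun x ↦ -6 / x ^ 4)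
    (f₄ := fun x ↦ 24 / x ^ 5) (f₅ := fun x ↦ -120 / x ^ 6) (f₆ := fun x ↦ 720 / x ^ 7)
    fun y hy ↦ by
      have hy0 : 0 < y := by linarith [hy.1, n.cast_nonneg (α := ℝ)]
      refine ⟨by simpa using Real.hasDerivAt_log hy0.ne', ?_, ?_, ?_, ?_, ?_, ?_,
        by positivity⟩ <;>
        exact hasDerivAt_const_div_pow hy0 (by norm_num) (by norm_num)
  have hsum := sum_range_ge_of_step (f := fun n : ℕ ↦ 1 / (x + n : ℝ) ^ 1)
    (Φ := fun n : ℕ ↦ Real.log (x + n) - 1 / (x + n : ℝ) ^ 1 / 2 +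
      -1 / (x + n : ℝ) ^ 2 / 12 - -6 / (x + n : ℝ) ^ 4 / 720)
    fun n ↦ by simpa only [Nat.cast_add, Nat.cast_one, add_assoc] using hstep n
  have hpow (c : ℝ) {p : ℕ} (hp : p ≠ 0) :
      Tendsto (fun n : ℕ ↦ c / (x + n : ℝ) ^ p) atTop (𝓝 0) :=
    tendsto_const_nhds.div_atTop ((tendsto_pow_atTop hp).comp
      (tendsto_atTop_add_const_left _ x tendsto_natCast_atTop_atTop))
  have hlim := ((((hpow 1 one_ne_zero).div_const 2).neg.add
    ((hpow (-1) two_ne_zero).div_const 12)).sub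
    ((hpow (-6) four_ne_zero).div_const 720)).add_const
      (-(Real.log x - 1 / (2 * x) - 1 / (12 * x ^ 2) + 1 / (120 * x ^ 4)))
  simp only [zero_div, neg_zero, add_zero, sub_zero, zero_add] at hlim
  refine neg_le_neg_iff.1 (le_of_tendsto_of_tendsto' hlim
    (tendsto_sum_inv_sub_log_digammaReal hx) fun N ↦ ?_)
  have := hsum N
  simp only [Nat.cast_zero, add_zero, pow_one] at this ⊢
  have e : 1 / x / 2 = 1 / (2 * x) ∧ -1 / x ^ 2 / 12 = -(1 / (12 * x ^ 2)) ∧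
      -6 / x ^ 4 / 720 = -(1 / (120 * x ^ 4)) := by
    refine ⟨?_, ?_, ?_⟩ <;> ring
  rw [e.1, e.2.1, e.2.2] at this
  linarith

theorem rational_lower_bound {v : ℝ} (h1 : -(1 / 3) < v) (h2 : v < 1 / 3) :
    0 < 1 / 2 - 203 / 500 - (v - v ^ 2 / 2 + v ^ 3 / 3 + 3 / 2 * v ^ 4) + 1 / (3 * (1 + v)) +
      1 / (27 * (1 + v) ^ 2) - 2 / (1215 * (1 + v) ^ 4) - 11 / 12 * (1 / 2 - 3 / 2 * v) -
      (1 / 2 - 3 / 2 * v) * (3 / 2 - 3 / 2 * v) * (5 / 2 - 3 / 2 * v) / 720 := by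
  have hv : 0 < 1 + v := by linarith
  set a := 1 + 3 * v with ha
  set b := 1 - 3 * v with hb
  have ha0 : 0 < a := by linarith
  have hb0 : 0 < b := by linarith
  have hr : 0 < 811241 / 373248000 * b ^ 6 + 9416311 / 373248000 * a * b ^ 5 +
      10307347 / 93312000 * a ^ 2 * b ^ 4 + 1660103 / 6912000 * a ^ 3 * b ^ 3 +
      101503253 / 373248000 * a ^ 4 * b ^ 2 + 54216863 / 373248000 * a ^ 5 * b +
      4483427 / 186624000 * a ^ 6 := by positivity
  have hq : 0 < 6947 / 3888000 - 2893 / 432000 * v + 1 / 20 * v ^ 2 := by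
    nlinarith [sq_nonneg (v - 67 / 1000)]
  have hp := add_pos_of_pos_of_nonneg hq (mul_nonneg (sq_nonneg v) hr.le)
  convert! div_pos hp (pow_pos hv 4) using 1
  rw [ha, hb]
  field_simp
  ring

theorem log_upper_bound {v : ℝ} (h1 : -(1 / 3) < v) (h2 : v < 1 / 3) :
    Real.log (3 / 2 * (1 + v)) ≤
      203 / 500 + (v - v ^ 2 / 2 + v ^ 3 / 3 + 3 / 2 * v ^ 4) := by
  have habs : |v| < 1 / 3 := abs_lt.2 ⟨h1, h2⟩
  have hlog : Real.log (3 / 2) ≤ 203 / 500 := by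
    rw [Real.log_le_iff_le_exp (by norm_num)]
    refine le_trans ?_ (Real.sum_le_exp_of_nonneg (by norm_num) 6)
    simp_rw [Finset.sum_range_succ, Nat.factorial_succ]
    norm_num
  have h := (abs_le.1 (Real.abs_log_sub_add_sum_range_le (x := -v)
    (by rw [abs_neg]; linarith) 3)).2
  have hb : |-v| ^ (3 + 1) / (1 - |-v|) ≤ 3 / 2 * v ^ 4 := by
    rw [abs_neg, div_le_iff₀ (by linarith), show 3 + 1 = 4 by rfl, Even.pow_abs (by decide)]
    nlinarith [mul_nonneg (by positivity : 0 ≤ v ^ 4) (by linarith : 0 ≤ 1 / 3 - |v|)]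
  simp only [Finset.sum_range_succ, Finset.sum_range_zero, sub_neg_eq_add] at h
  norm_num at h
  rw [Real.log_mul (by norm_num) (by linarith)]
  norm_num at hb
  nlinarith

theorem lt_riemannZeta_sub_digammaReal {s : ℝ} (hs : 0 < s) (hs1 : s < 1) :
    s < (riemannZeta s).re + 1 / (1 - s) - digammaReal (2 - s) := by
  have hz := riemannZeta_lower_bound hs hs1
  have hd := digammaReal_upper_bound (by linarith : 0 < 2 - s)
  obtain ⟨v, rfl⟩ : ∃ v, s = 1 / 2 - 3 / 2 * v := ⟨(1 / 2 - s) * (2 / 3), by ring⟩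
  have h1 : -(1 / 3) < v := by linarith
  have h2 : v < 1 / 3 := by linarith
  have hl := log_upper_bound h1 h2
  have hr := rational_lower_bound h1 h2
  have hv : 0 < 1 + v := by linarith
  rw [show 2 - (1 / 2 - 3 / 2 * v) = 3 / 2 * (1 + v) by ring] at hd ⊢
  have e1 : 1 / (2 * (3 / 2 * (1 + v))) = 1 / (3 * (1 + v)) := by ring
  have e2 : 1 / (12 * (3 / 2 * (1 + v)) ^ 2) = 1 / (27 * (1 + v) ^ 2) := by ring
  have e3 : 1 / (120 * (3 / 2 * (1 + v)) ^ 4) = 2 / (1215 * (1 + v) ^ 4) := by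
    field_simp; norm_num
  rw [e1, e2, e3] at hd
  linarith

theorem riemannZeta_upper_bound_step {s a : ℝ} (hs : 0 < s) (hs1 : s < 1) (ha : 1 ≤ a) :
    ((a + 1) ^ (-s) - s / (a + 1)) / 2 - ((a + 1) ^ (1 - s) / (1 - s) - s * Real.log (a + 1)) +
        s * (1 - s) / 4 / (a + 1) ≤
      (a ^ (-s) - s / a) / 2 - (a ^ (1 - s) / (1 - s) - s * Real.log a) + s * (1 - s) / 4 / a +
        -(a ^ (-s) - s / a) := by
  have h1s : 1 - s ≠ 0 := by linarith
  have key := le_of_hasDerivAt_nonpos (a := a)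
    (f := fun x ↦ (x - a) * (1 - (x - a)) / 2 * (-s * x ^ (-(s + 1)) + s / x ^ 2) -
      (1 / 2 - (x - a)) * (1 * x ^ (-s) - s / x ^ 1) -
      (1 / (1 - s) * x ^ (1 - s) - s * Real.log x) + s * (1 - s) / 4 / x ^ 1)
    (f' := fun x ↦ (x - a) * (1 - (x - a)) / 2 *
      (s * (s + 1) * x ^ (-(s + 2)) + -(2 * s) / x ^ 3) + -(s * (1 - s) / 4) / x ^ 2)
    (fun x hx ↦ ?_) (fun x hx ↦ ?_)
  · simp only [pow_one] at key
    ring_nf at key ⊢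
    linarith
  · have hx0 : 0 < x := by linarith [hx.1]
    have ht : HasDerivAt (fun x ↦ x - a) 1 x := (hasDerivAt_id x).sub_const a
    have hF : HasDerivAt (fun x : ℝ ↦ 1 / (1 - s) * x ^ (1 - s)) (1 * x ^ (-s)) x :=
      hasDerivAt_const_mul_rpow hx0 (by ring) (by field_simp)
    have hf : HasDerivAt (fun x : ℝ ↦ 1 * x ^ (-s)) (-s * x ^ (-(s + 1))) x :=
      hasDerivAt_const_mul_rpow hx0 (by ring) (by ring)
    have hf₁ : HasDerivAt (fun x : ℝ ↦ -s * x ^ (-(s + 1))) (s * (s + 1) * x ^ (-(s + 2))) x :=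
      hasDerivAt_const_mul_rpow hx0 (by ring) (by ring)
    have hg : HasDerivAt (fun x : ℝ ↦ s / x ^ 1) (-s / x ^ 2) x :=
      hasDerivAt_const_div_pow hx0 (by norm_num) (by norm_num)
    have hg₁ : HasDerivAt (fun x : ℝ ↦ s / x ^ 2) (-(2 * s) / x ^ 3) x :=
      hasDerivAt_const_div_pow hx0 (by norm_num) (by push_cast; ring)
    have hc : HasDerivAt (fun x : ℝ ↦ s * (1 - s) / 4 / x ^ 1) (-(s * (1 - s) / 4) / x ^ 2) x :=
      hasDerivAt_const_div_pow hx0 (by norm_num) (by norm_num)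
    convert! (((((ht.mul (ht.const_sub 1)).div_const 2).mul (hf₁.add hg₁)).sub
      ((ht.const_sub (1 / 2)).mul (hf.sub hg))).sub
      (hF.sub ((Real.hasDerivAt_log hx0.ne').const_mul s))).add hc using 1
    simp only [Pi.add_apply, Pi.sub_apply, Pi.mul_apply]
    field_simp
    ring
  · have hx1 : 1 ≤ x := ha.trans hx.1
    have hx0 : 0 < x := by linarith
    have hy : x ^ (1 - s) ≤ 1 + (1 - s) * (x - 1) := by
      simpa using rpow_one_add_le_one_add_mul_self (s := x - 1) (by linarith)
        (by linarith : 0 ≤ 1 - s) (by linarith)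
    have hpow : x ^ (-(s + 2)) = x ^ (1 - s) / x ^ 3 := by
      rw [← Real.rpow_sub_natCast hx0.ne']
      norm_num
      ring_nf
    have hq0 : 0 ≤ (x - a) * (1 - (x - a)) / 2 :=
      div_nonneg (mul_nonneg (by linarith [hx.1]) (by linarith [hx.2])) two_pos.le
    have hq1 : (x - a) * (1 - (x - a)) / 2 ≤ 1 / 8 := by nlinarith [sq_nonneg (x - a - 1 / 2)]
    have hb : s * (s + 1) * x ^ (-(s + 2)) + -(2 * s) / x ^ 3 ≤ 2 * (s * (1 - s)) / x ^ 2 := by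
      have : s * ((s + 1) * x ^ (1 - s) - 2) ≤ s * (2 * (1 - s) * x) := by
        refine mul_le_mul_of_nonneg_left ?_ hs.le
        nlinarith [mul_le_mul_of_nonneg_left hy (by linarith : 0 ≤ s + 1),
          mul_nonneg (sq_nonneg (1 - s)) (sub_nonneg.2 hx1)]
      rw [hpow, show s * (s + 1) * (x ^ (1 - s) / x ^ 3) + -(2 * s) / x ^ 3 =
        s * ((s + 1) * x ^ (1 - s) - 2) / x ^ 3 by ring,
        show 2 * (s * (1 - s)) / x ^ 2 = s * (2 * (1 - s) * x) / x ^ 3 by field_simp]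
      gcongr
    have hc : 0 ≤ 2 * (s * (1 - s)) / x ^ 2 :=
      div_nonneg (by nlinarith) (by positivity)
    calc _ ≤ 1 / 8 * (2 * (s * (1 - s)) / x ^ 2) + -(s * (1 - s) / 4) / x ^ 2 := by
          gcongr ?_ + _
          exact (mul_le_mul_of_nonneg_left hb hq0).trans (mul_le_mul_of_nonneg_right hq1 hc)
      _ = 0 := by ring
      _ ≤ 0 := le_rfl

theorem digammaReal_one : digammaReal 1 = -Real.eulerMascheroniConstant := by
  rw [digammaReal, Real.eulerMascheroniConstant_eq_neg_deriv, Real.Gamma_one, div_one, neg_neg]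

theorem tendsto_sum_inv_sub_log :
    Tendsto (fun N : ℕ ↦ ∑ k ∈ Finset.range N, 1 / (1 + k : ℝ) - Real.log (1 + N)) atTop
      (𝓝 Real.eulerMascheroniConstant) := by
  simpa only [digammaReal_one, neg_neg] using tendsto_sum_inv_sub_log_digammaReal one_pos

theorem riemannZeta_upper_bound {s : ℝ} (hs : 0 < s) (hs1 : s < 1) :
    (riemannZeta s).re ≤
      s * Real.eulerMascheroniConstant + (1 - s) / 2 - 1 / (1 - s) + s * (1 - s) / 4 := by
  have hsum := sum_range_ge_of_step
    (f := fun n : ℕ ↦ -((n + 1 : ℝ) ^ (-s) - s / (n + 1)))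
    (Φ := fun n : ℕ ↦ ((n + 1 : ℝ) ^ (-s) - s / (n + 1)) / 2 -
      ((n + 1 : ℝ) ^ (1 - s) / (1 - s) - s * Real.log (n + 1)) + s * (1 - s) / 4 / (n + 1))
    fun n ↦ by
      simpa only [Nat.cast_add, Nat.cast_one] using
        riemannZeta_upper_bound_step hs hs1 (by simp : (1 : ℝ) ≤ n + 1)
  have hinv (c : ℝ) : Tendsto (fun N : ℕ ↦ c / (N + 1 : ℝ)) atTop (𝓝 0) :=
    tendsto_const_nhds.div_atTop
      (tendsto_atTop_add_const_right _ (1 : ℝ) tendsto_natCast_atTop_atTop)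
  have hlim := ((((tendsto_add_one_rpow_neg hs).sub (hinv s)).div_const 2).add
    (hinv (s * (1 - s) / 4))).const_sub ((1 - s) / 2 - 1 / (1 - s) + s * (1 - s) / 4)
    |>.add (tendsto_sum_inv_sub_log.const_mul s)
  have hle := le_of_tendsto_of_tendsto' (tendsto_sum_rpow_sub_riemannZeta hs hs1) hlim fun N ↦ by
    have := hsum N
    simp only [Nat.cast_zero, zero_add, Real.one_rpow, Real.log_one, div_one, mul_zero, sub_zero,
      Finset.sum_neg_distrib, Finset.sum_sub_distrib] at this
    have hmul : s * (∑ k ∈ Finset.range N, 1 / (1 + k : ℝ) - Real.log (1 + N)) =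
        ∑ k ∈ Finset.range N, s / (k + 1 : ℝ) - s * Real.log (N + 1) := by
      simp only [mul_sub, Finset.mul_sum, mul_one_div, add_comm (1 : ℝ)]
    rw [hmul]
    linarith
  linarith

theorem sum_inv_sub_inv_ge {u : ℝ} (hu : 0 < u) (hu1 : u < 1) {N : ℕ} (hN : 2 ≤ N) :
    u * (1 - 1 / (N + 1)) + 11 / 36 * (u * (1 - u)) ≤
      ∑ k ∈ Finset.range N, 1 / (1 + k : ℝ) - ∑ k ∈ Finset.range N, 1 / (1 + u + k) := by
  induction N, hN using Nat.le_induction with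
  | base =>
    have h1 : u * ((3 - u) / 4) ≤ 1 - 1 / (1 + u) := by
      rw [show 1 - 1 / (1 + u) = u * (1 / (1 + u)) by field_simp; ring]
      refine mul_le_mul_of_nonneg_left ?_ hu.le
      rw [div_le_div_iff₀ (by norm_num) (by linarith)]
      nlinarith [sq_nonneg (1 - u)]
    have h2 : u * ((4 - u) / 18) ≤ 1 / 2 - 1 / (2 + u) := by
      rw [show 1 / 2 - 1 / (2 + u) = u * (1 / (2 * (2 + u))) by field_simp; ring]
      refine mul_le_mul_of_nonneg_left ?_ hu.le
      rw [div_le_div_iff₀ (by norm_num) (by linarith)]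
      nlinarith [sq_nonneg (1 - u)]
    simp only [Finset.sum_range_succ, Finset.sum_range_zero]
    norm_num
    rw [show 1 + u + 1 = 2 + u by ring]
    norm_num at h1 h2
    linarith
  | succ N hN ih =>
    have hN0 : (0 : ℝ) ≤ N := N.cast_nonneg
    have h : u * (1 / (N + 1) - 1 / (N + 1 + 1)) ≤ 1 / (1 + N : ℝ) - 1 / (1 + u + N) := by
      rw [show (1 / (N + 1) - 1 / (N + 1 + 1) : ℝ) = 1 / ((N + 1) * (N + 1 + 1)) by
        field_simp; ring, show 1 / (1 + N : ℝ) - 1 / (1 + u + N) =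
          u * (1 / ((N + 1) * (1 + u + N))) by field_simp; ring]
      exact mul_le_mul_of_nonneg_left (one_div_le_one_div_of_le (by positivity)
        (mul_le_mul_of_nonneg_left (by linarith) (by positivity))) hu.le
    rw [Finset.sum_range_succ, Finset.sum_range_succ]
    push_cast
    linarith

theorem digammaReal_one_add_lower_bound {u : ℝ} (hu : 0 < u) (hu1 : u < 1) :
    -digammaReal (1 + u) ≤
      Real.eulerMascheroniConstant - u - 11 / 36 * (u * (1 - u)) := by
  have hinv : Tendsto (fun N : ℕ ↦ 1 / (N + 1 : ℝ)) atTop (𝓝 0) :=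
    tendsto_one_div_add_atTop_nhds_zero_nat
  have hlim := tendsto_sum_inv_sub_log.sub
    (((hinv.const_sub 1).const_mul u).add_const (11 / 36 * (u * (1 - u))))
  have hle := le_of_tendsto_of_tendsto
    (tendsto_sum_inv_sub_log_digammaReal (by linarith : 0 < 1 + u)) hlim <| by
      filter_upwards [eventually_ge_atTop 2] with N hN
      have h := sum_inv_sub_inv_ge hu hu1 hN
      have hlog : Real.log (1 + N) ≤ Real.log (1 + u + N) :=
        Real.log_le_log (by positivity) (by linarith)
      linarith
  linarith

theorem riemannZeta_sub_digammaReal_lt {s : ℝ} (hs : 0 < s) (hs1 : s < 1) :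
    (riemannZeta s).re + 1 / (1 - s) - digammaReal (2 - s) <
      (Real.eulerMascheroniConstant + 1 / 2) * s + (Real.eulerMascheroniConstant - 1 / 2) := by
  have hz := riemannZeta_upper_bound hs hs1
  have hd := digammaReal_one_add_lower_bound (sub_pos.2 hs1) (by linarith)
  rw [show 1 + (1 - s) = 2 - s by ring] at hd
  nlinarith [mul_pos hs (sub_pos.2 hs1)]

end

theorem stmt_19 (s : ℝ) (hs : 0 < s) (hs1 : s < 1) :
    Real.pi * Real.cot (Real.pi * s) + s < (riemannZeta s).re - digammaReal s ∧
      (riemannZeta s).re - digammaReal s <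
        Real.pi * Real.cot (Real.pi * s) +
          (Real.eulerMascheroniConstant + 1 / 2) * s +
          (Real.eulerMascheroniConstant - 1 / 2) := by
  have h1 := lt_riemannZeta_sub_digammaReal hs hs1
  have h2 := riemannZeta_sub_digammaReal_lt hs hs1
  have h3 := digammaReal_add_one (sub_pos.2 hs1)
  rw [digammaReal_one_sub hs hs1, show 1 - s + 1 = 2 - s by ring] at h3
  constructor <;> linarith
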